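/- There exists a uniformly Σ¹₁ family (Aₙ) of cofinite subsets of ℕ such that for every uniformly Σ¹₁ family (Bₙ) with each Bₙ either all of ℕ or nonempty and finite, ∏ₙAₙ is not Medvedev reducible to ∏ₙBₙ. -/

import Mathlib

open Set

/-- Baire space. -/
abbrev Baire : Type := ℕ → ℕ

/-- The length-`n` initial segment of `x : Baire`, as a finite sequence. -/
def pre (x : Baire) (n : ℕ) : List ℕ := (List.range n).map x

/-- A Turing functional, presented by a total computable monotone map on
finite sequences. -/
structure TuringFunctional where
  φ : List ℕ → List ℕ
  computable : Computable φ
  mono : ∀ σ τ : List ℕ, σ <+: τ → φ σ <+: φ τ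

/-- `Φ` is defined on `x` with value `y`: every coordinate of `y` is eventually
output by `Φ` on initial segments of `x`. -/
def TuringFunctional.Eval (Φ : TuringFunctional) (x y : Baire) : Prop :=
  ∀ n, ∃ m, (Φ.φ (pre x m))[n]? = some (y n)

/-- Medvedev reducibility: some Turing functional is defined on every element
of `Q` and maps `Q` into `P`. -/
def MedvedevLE (P Q : Set Baire) : Prop :=
  ∃ Φ : TuringFunctional, ∀ x ∈ Q, ∃ y ∈ P, Φ.Eval x y

/-- Strict Medvedev reducibility. -/
def MedvedevLT (P Q : Set Baire) : Prop := MedvedevLE P Q ∧ ¬ MedvedevLE Q P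

/-- The homogeneous set `∏ₙ Aₙ`. -/
def homProd (A : ℕ → Set ℕ) : Set Baire := {x | ∀ n, x n ∈ A n}

/-- A family `(Aₙ)` of subsets of `ℕ` is uniformly `Σ¹₁`. -/
def UniformlySigma11 (A : ℕ → Set ℕ) : Prop :=
  ∃ R : ℕ × ℕ → List ℕ → Bool, Computable₂ R ∧
    ∀ n m : ℕ, m ∈ A n ↔ ∃ y : Baire, ∀ k, R (n, m) (pre y k) = true

/-- A subset of Baire space is (lightface) `Σ¹₁`. -/
def Sigma11Set (S : Set Baire) : Prop :=
  ∃ R : List ℕ → List ℕ → Bool, Computable₂ R ∧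
    ∀ x, x ∈ S ↔ ∃ y : Baire, ∀ m, R (pre x m) (pre y m) = true

/-- A set of finite sequences is (lightface) `Σ¹₁`. -/
def Sigma11List (T : Set (List ℕ)) : Prop :=
  ∃ R : List ℕ → List ℕ → Bool, Computable₂ R ∧
    ∀ σ, σ ∈ T ↔ ∃ y : Baire, ∀ m, R σ (pre y m) = true

/-- A tree on `ℕ`: a set of finite sequences closed under prefixes. -/
def IsTree (T : Set (List ℕ)) : Prop := ∀ σ ∈ T, ∀ τ : List ℕ, τ <+: σ → τ ∈ T

/-- The set `[T]` of infinite paths through `T`. -/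
def paths (T : Set (List ℕ)) : Set Baire := {x | ∀ n, pre x n ∈ T}

/-- A subset of `ℕ × ℕ` is (lightface) `Σ¹₁`. -/
def Sigma11Pairs (A : Set (ℕ × ℕ)) : Prop :=
  ∃ R : ℕ × ℕ → List ℕ → Bool, Computable₂ R ∧
    ∀ p : ℕ × ℕ, p ∈ A ↔ ∃ y : Baire, ∀ k, R p (pre y k) = true

/-- A function `f : ℕ → ℕ` is `Δ¹₁`: its graph is both `Σ¹₁` and `Π¹₁`. -/
def Delta11Fun (f : ℕ → ℕ) : Prop :=
  Sigma11Pairs {p : ℕ × ℕ | f p.1 = p.2} ∧ Sigma11Pairs {p : ℕ × ℕ | f p.1 ≠ p.2}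

open Encodable Denumerable

/-! ### Initial segments -/

lemma pre_length (x : Baire) (m : ℕ) : (pre x m).length = m := by simp [pre]

lemma pre_succ (x : Baire) (m : ℕ) : pre x (m + 1) = pre x m ++ [x m] := by
  simp [pre, List.range_succ]

lemma pre_succ' (x : Baire) (m : ℕ) : pre x (m + 1) = x 0 :: pre (fun j => x (j + 1)) m := by
  simp [pre, List.range_succ_eq_map, Function.comp_def]

lemma pre_take (x : Baire) (m j : ℕ) : (pre x m).take j = pre x (min j m) := by
  simp [pre, ← List.map_take, List.take_range]

lemma pre_getD (x : Baire) {m j : ℕ} (h : j < m) : (pre x m).getD j 0 = x j := by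
  simp [pre, List.getD_eq_getElem?_getD, h]

lemma pre_drop (x : Baire) (m i : ℕ) : (pre x m).drop i = pre (fun j => x (i + j)) (m - i) := by
  apply List.ext_getElem <;> simp [pre]

lemma pre_map (x : Baire) (m : ℕ) (f : ℕ → ℕ) : (pre x m).map f = pre (fun j => f (x j)) m := by
  simp [pre, Function.comp_def]

/-- Dependent choice along one-step extensions of finite sequences. -/
lemma exists_path {P : List ℕ → Prop} (h0 : P []) (hs : ∀ s, P s → ∃ c, P (s ++ [c])) :
    ∃ z : Baire, ∀ m, P (pre z m) := by
  classical
  choose! c hc using hs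
  let l : ℕ → List ℕ := Nat.rec [] (fun _ s => s ++ [c s])
  have hl : ∀ m, pre (fun m => c (l m)) m = l m := by
    intro m
    induction m with
    | zero => rfl
    | succ m ih => rw [pre_succ, ih]
  refine ⟨fun m => c (l m), fun m => ?_⟩
  rw [hl]
  induction m with
  | zero => exact h0
  | succ m ih => exact hc _ ih

/-! ### Comparison of ranks of trees -/

/-- `Outruns T₁ T₂ t s`: the rank of `T₁` above `t` exceeds the (ordinal) rank of `T₂`
above `s`. -/
inductive Outruns (T₁ T₂ : List ℕ → Prop) : List ℕ → List ℕ → Prop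
  | step {t s : List ℕ} (n : ℕ) : T₁ (t ++ [n]) →
      (∀ c, T₂ (s ++ [c]) → Outruns T₁ T₂ (t ++ [n]) (s ++ [c])) → Outruns T₁ T₂ t s

lemma Outruns.anti {T₁ T₂ T₂' : List ℕ → Prop} (hT : ∀ s, T₂' s → T₂ s) {t s : List ℕ}
    (h : Outruns T₁ T₂ t s) : Outruns T₁ T₂' t s := by
  induction h with
  | step n hn _ ih => exact .step n hn fun c hc => ih c (hT _ hc)

lemma exists_response {T₁ T₂ : List ℕ → Prop} {t s : List ℕ} (h : ¬ Outruns T₁ T₂ t s) {n : ℕ}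
    (hn : T₁ (t ++ [n])) : ∃ c, T₂ (s ++ [c]) ∧ ¬ Outruns T₁ T₂ (t ++ [n]) (s ++ [c]) := by
  by_contra! hc
  exact h (.step n hn hc)

lemma exists_path_of_not_outruns {T₁ T₂ : List ℕ → Prop} (h : ¬ Outruns T₁ T₂ [] [])
    {y : Baire} (hy : ∀ m, T₁ (pre y (m + 1))) : ∃ z : Baire, ∀ m, T₂ (pre z (m + 1)) := by
  obtain ⟨z, hz⟩ := exists_path
    (P := fun s => ¬ Outruns T₁ T₂ (pre y s.length) s ∧ (s ≠ [] → T₂ s)) ⟨h, by simp⟩ (by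
      rintro s ⟨hs, -⟩
      obtain ⟨c, hc, hc'⟩ := exists_response hs (n := y s.length) (by
        rw [← pre_succ]; exact hy _)
      refine ⟨c, ?_, fun _ => hc⟩
      simpa [pre_succ] using hc')
  refine ⟨z, fun m => (hz (m + 1)).2 ?_⟩
  simp [pre_succ]

lemma not_forall_outruns_succ (S : ℕ → List ℕ → Prop) (t : ℕ → List ℕ) :
    ¬ ∀ j, Outruns (S j) (S (j + 1)) (t j) (t (j + 1)) := by
  intro h
  suffices H : ∀ a b, Outruns (S 0) (S 1) a b → ∀ t : ℕ → List ℕ, t 0 = a → t 1 = b →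
      (∀ j, Outruns (S j) (S (j + 1)) (t j) (t (j + 1))) → False from H _ _ (h 0) t rfl rfl h
  intro a b hab
  induction hab with
  | @step a b n hn hab ih =>
    rintro t rfl rfl ht
    have key : ∀ j, ∃ n, S j (t j ++ [n]) ∧ ∀ c, S (j + 1) (t (j + 1) ++ [c]) →
        Outruns (S j) (S (j + 1)) (t j ++ [n]) (t (j + 1) ++ [c]) := fun j => by
      cases ht j with
      | step n h1 h2 => exact ⟨n, h1, h2⟩
    choose N hN hN' using key
    let M : ℕ → ℕ := Function.update N 0 n
    have hM1 : ∀ j, S j (t j ++ [M j]) := fun j => by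
      rcases j with _ | j
      · exact hn
      · exact hN _
    have hM2 : ∀ j c, S (j + 1) (t (j + 1) ++ [c]) →
        Outruns (S j) (S (j + 1)) (t j ++ [M j]) (t (j + 1) ++ [c]) := fun j => by
      rcases j with _ | j
      · exact hab
      · exact hN' _
    exact ih (M 1) (hM1 1) (fun j => t j ++ [M j]) rfl rfl fun j => hM2 j _ (hM1 _)

/-- Ordinals admit no infinite descent: in a decreasing sequence of trees, only finitely many
have a rank that exceeds the rank of some other member. -/
lemma finite_outruns {S : ℕ → List ℕ → Prop} (hS : ∀ a b, a ≤ b → ∀ t, S b t → S a t) :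
    {k | ∃ b, Outruns (S k) (S b) [] []}.Finite := by
  by_contra hinf
  have hinf' := not_bddAbove_iff.1 (mt BddAbove.finite hinf)
  have next : ∀ k, (∃ b, Outruns (S k) (S b) [] []) →
      ∃ k', (∃ b, Outruns (S k') (S b) [] []) ∧ Outruns (S k) (S k') [] [] := by
    rintro k ⟨b, hb⟩
    obtain ⟨k', hk', hlt⟩ := hinf' b
    exact ⟨k', hk', hb.anti (hS _ _ hlt.le)⟩
  choose! f hf hf' using next
  obtain ⟨k, hk, -⟩ := hinf' 0
  have hk' : ∀ j, ∃ b, Outruns (S (f^[j] k)) (S b) [] [] := fun j => by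
    induction j with
    | zero => exact hk
    | succ j ih => rw [Function.iterate_succ_apply']; exact hf _ ih
  refine not_forall_outruns_succ (fun j => S (f^[j] k)) (fun _ => []) fun j => ?_
  simp only [Function.iterate_succ_apply']
  exact hf' _ (hk' j)

/-! ### The removed values -/

section Removed

variable (g : List ℕ → ℕ) (N : ℕ → ℕ → List ℕ → Prop)

/-- Attempts to put `k` into the `i`-th set, delayed by `i` steps. -/
def compTree (i k : ℕ) (t : List ℕ) : Prop := N i k (t.drop i)

/-- Attempts to find an element `≥ b` of the `i`-th set. -/
def boundTree (i b : ℕ) (t : List ℕ) : Prop := b ≤ t.headI ∧ N i t.headI t.tail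

/-- The `i`-th witness coded in `p`. -/
def track (p : List ℕ) (i : ℕ) : List ℕ :=
  (p.drop i).map fun z => (ofNat (List ℕ) z.unpair.2).getD i 0

/-- Attempts to find a member of the product at which `g` vanishes forever. -/
def undefTree (p : List ℕ) : Prop :=
  g (p.map fun z => z.unpair.1) = 0 ∧
    ∀ i < p.length, N i ((p.map fun z => z.unpair.1).getD i 0) (track p i)

/-- The candidate values at coordinate `i`. -/
def Cand (i k : ℕ) : Prop :=
  (k = 0 ∨ ∃ b, Outruns (boundTree N i k) (boundTree N i b) [] []) ∧
    Outruns (compTree N i k) (undefTree g N) [] []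

/-- `σ` is a minimal sequence at which `g` takes the value `v + 1`. -/
def Settles (v : ℕ) (σ : List ℕ) : Prop :=
  g σ = v + 1 ∧ ∀ j < σ.length, g (σ.take j) = 0

/-- The values to be excluded. -/
def Removed (v : ℕ) : Prop :=
  ∃ σ, Settles g v σ ∧ ∀ i < σ.length, Cand g N i (σ.getD i 0)

variable {g N}

lemma cand_finite (i : ℕ) : {k | Cand g N i k}.Finite := by
  refine ((Set.finite_singleton 0).union
    (finite_outruns (S := boundTree N i) fun a b hab t h => ⟨hab.trans h.1, h.2⟩)).subset ?_
  rintro k ⟨rfl | h, -⟩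
  · exact Or.inl rfl
  · exact Or.inr h

lemma track_pre (z : Baire) (m i : ℕ) :
    track (pre z m) i =
      pre (fun j => (ofNat (List ℕ) (z (i + j)).unpair.2).getD i 0) (m - i) := by
  rw [track, pre_drop, pre_map]

lemma exists_not_outruns {x : Baire} (hx : ∀ m, g (pre x m) = 0) :
    ∃ i, ¬ Outruns (compTree N i (x i)) (undefTree g N) [] [] := by
  by_contra! h
  suffices H : ∀ a p, Outruns (compTree N 0 (x 0)) (undefTree g N) a p → ∀ t : ℕ → List ℕ,
      t 0 = a → (∀ i, (t i).length = p.length) → (p.map fun z => z.unpair.1) = pre x p.length →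
      (∀ i, track p i = (t i).drop i) →
      (∀ i, Outruns (compTree N i (x i)) (undefTree g N) (t i) p) → False from
    H _ _ (h 0) (fun _ => []) rfl (by simp) (by simp [pre]) (by simp [track]) h
  intro a p hap
  induction hap with
  | @step a p n hn hap ih =>
    rintro t rfl hlen hp htr ht
    have key : ∀ i, ∃ n, compTree N i (x i) (t i ++ [n]) ∧ ∀ c, undefTree g N (p ++ [c]) →
        Outruns (compTree N i (x i)) (undefTree g N) (t i ++ [n]) (p ++ [c]) := fun i => by
      cases ht i with
      | step n h1 h2 => exact ⟨n, h1, h2⟩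
    choose K hK hK' using key
    let M : ℕ → ℕ := Function.update K 0 n
    have hM1 : ∀ i, compTree N i (x i) (t i ++ [M i]) := fun i => by
      rcases i with _ | i
      · exact hn
      · exact hK _
    have hM2 : ∀ i c, undefTree g N (p ++ [c]) →
        Outruns (compTree N i (x i)) (undefTree g N) (t i ++ [M i]) (p ++ [c]) := fun i => by
      rcases i with _ | i
      · exact hap
      · exact hK' _
    let c : ℕ := Nat.pair (x p.length) (encode (pre M (p.length + 1)))
    have hpc : ((p ++ [c]).map fun z => z.unpair.1) = pre x (p ++ [c]).length := by
      simp [hp, pre_succ, c]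
    have htc : ∀ i, track (p ++ [c]) i = (t i ++ [M i]).drop i := fun i => by
      rcases lt_or_ge p.length i with hi | hi
      · rw [track, List.drop_eq_nil_of_le (by simp; omega),
          List.drop_eq_nil_of_le (by simp [hlen]; omega)]
        rfl
      · rw [List.drop_append_of_le_length (by simp [hlen, hi]), ← htr, track,
          List.drop_append_of_le_length hi, List.map_append, track]
        have hM := pre_getD M (Nat.lt_succ_of_le hi)
        rw [List.getD_eq_getElem?_getD] at hM
        simp [c, hM]
    have hu : undefTree g N (p ++ [c]) := by
      refine ⟨by rw [hpc]; exact hx _, fun i hi => ?_⟩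
      rw [hpc, pre_getD x hi, htc]
      exact hM1 i
    exact ih c hu (fun i => t i ++ [M i]) rfl (by simp [hlen]) hpc htc fun i => hM2 i c hu

lemma removed_finite : {v | Removed g N v}.Finite := by
  by_contra hinf
  let V : List ℕ → Set ℕ := fun τ => {v | ∃ σ, τ <+: σ ∧ Settles g v σ ∧
    ∀ i < σ.length, Cand g N i (σ.getD i 0)}
  obtain ⟨x, hx⟩ := exists_path (P := fun τ => (V τ).Infinite)
    (fun hfin => hinf (hfin.subset fun v ⟨σ, hs, hc⟩ => ⟨σ, List.nil_prefix, hs, hc⟩)) (by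
      intro τ hτ
      by_contra! hfin
      refine hτ ((((cand_finite (g := g) (N := N) τ.length).biUnion
        (t := fun k => V (τ ++ [k])) fun k _ => hfin k).union
        (Set.finite_singleton (g τ - 1))).subset ?_)
      rintro v ⟨_, ⟨ρ, rfl⟩, hs, hc⟩
      rcases ρ with _ | ⟨k, ρ⟩
      · right; simp [Settles] at hs; simp [hs.1]
      · left
        refine Set.mem_iUnion₂.2 ⟨k, ?_, τ ++ k :: ρ, ⟨ρ, by simp⟩, hs, hc⟩
        have := hc τ.length (by simp)
        simpa [List.getD_eq_getElem?_getD] using this)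
  have hx0 : ∀ m, g (pre x m) = 0 := fun m => by
    obtain ⟨v, σ, hσ, hs, -⟩ := (hx (m + 1)).nonempty
    have h1 := hσ.length_le
    rw [pre_length] at h1
    have h2 := hs.2 m (by omega)
    obtain ⟨ρ, rfl⟩ := hσ
    rwa [List.take_append_of_le_length (by simp [pre_length]), pre_take,
      min_eq_left (Nat.le_succ m)] at h2
  obtain ⟨i, hi⟩ := exists_not_outruns (N := N) hx0
  obtain ⟨v, σ, hσ, -, hc⟩ := (hx (i + 1)).nonempty
  have h1 := hσ.length_le
  rw [pre_length] at h1
  have h2 := (hc i (by omega)).2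
  obtain ⟨ρ, rfl⟩ := hσ
  rw [List.getD_append _ _ _ _ (by simp [pre_length]), pre_getD x (by omega)] at h2
  exact hi h2

end Removed

/-! ### Closure properties of `Σ¹₁` predicates -/

section Sigma

variable {α β : Type*} [Primcodable α] [Primcodable β]

/-- A `Σ¹₁` predicate, with a primitive recursive matrix. -/
def IsSigma11 (P : α → Prop) : Prop :=
  ∃ R : α × List ℕ → Prop, PrimrecPred R ∧ ∀ a, P a ↔ ∃ y : Baire, ∀ k, R (a, pre y k)

lemma PrimrecPred.ballLT {p : α → ℕ → Prop} (hp : PrimrecRel p) {f : α → ℕ} (hf : Primrec f) :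
    PrimrecPred fun a => ∀ k < f a, p a k :=
  ((PrimrecRel.forall_mem_list (R := fun k a => p a k) hp.swap).comp
    (Primrec.list_range.comp hf) Primrec.id).of_eq fun a => by simp [List.mem_range]

lemma PrimrecPred.imp {p q : α → Prop} (hp : PrimrecPred p) (hq : PrimrecPred q) :
    PrimrecPred fun a => p a → q a :=
  (hp.not.or hq).of_eq fun a => by tauto

lemma IsSigma11.of_eq {P Q : α → Prop} (hP : IsSigma11 P) (h : ∀ a, P a ↔ Q a) :
    IsSigma11 Q := by
  obtain ⟨R, hR, hR'⟩ := hP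
  exact ⟨R, hR, fun a => (h a).symm.trans (hR' a)⟩

lemma IsSigma11.comp {P : β → Prop} (hP : IsSigma11 P) {f : α → β} (hf : Primrec f) :
    IsSigma11 fun a => P (f a) := by
  obtain ⟨R, hR, hR'⟩ := hP
  exact ⟨fun p => R (f p.1, p.2), hR.comp ((hf.comp .fst).pair .snd), fun a => hR' _⟩

lemma PrimrecPred.isSigma11 {P : α → Prop} (hP : PrimrecPred P) : IsSigma11 P :=
  ⟨fun p => P p.1, hP.comp .fst, fun a => by simp⟩

lemma IsSigma11.ite {P Q c : α → Prop} (hc : PrimrecPred c) (hP : IsSigma11 P)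
    (hQ : IsSigma11 Q) : IsSigma11 fun a => (c a ∧ P a) ∨ (¬ c a ∧ Q a) := by
  obtain ⟨R, hR, hR'⟩ := hP
  obtain ⟨S, hS, hS'⟩ := hQ
  refine ⟨fun p => (c p.1 ∧ R p) ∨ (¬ c p.1 ∧ S p),
    ((hc.comp .fst).and hR).or ((hc.comp .fst).not.and hS), fun a => ?_⟩
  by_cases h : c a <;> simp [h, hR', hS']

lemma IsSigma11.exists_nat {P : α × ℕ → Prop} (hP : IsSigma11 P) :
    IsSigma11 fun a => ∃ n, P (a, n) := by
  obtain ⟨R, hR, hR'⟩ := hP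
  refine ⟨fun p => p.2.length = 0 ∨ R ((p.1, p.2.headI), p.2.tail),
    (Primrec.eq.comp (Primrec.list_length.comp .snd) (.const 0)).or (hR.comp
      ((Primrec.fst.pair (Primrec.list_headI.comp .snd)).pair (Primrec.list_tail.comp .snd))),
    fun a => ⟨?_, ?_⟩⟩
  · rintro ⟨n, hn⟩
    obtain ⟨y, hy⟩ := (hR' _).1 hn
    refine ⟨fun j => Nat.casesOn j n y, fun k => ?_⟩
    rcases k with _ | k
    · left; rfl
    · right
      rw [pre_succ']
      exact hy k
  · rintro ⟨y, hy⟩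
    refine ⟨y 0, (hR' _).2 ⟨fun j => y (j + 1), fun k => ?_⟩⟩
    simpa [pre_succ'] using hy (k + 1)

/-- The quantifier pattern `∃ y ∀ b`, with a matrix depending on a long enough initial segment
of `y`. -/
lemma isSigma11_exists_forall {γ : Type*} [Denumerable γ] {D : (α × γ) × List ℕ → Prop}
    (hD : PrimrecPred D) {u : γ → ℕ} (hu : Primrec u) :
    IsSigma11 fun a => ∃ y : Baire, ∀ b, D ((a, b), pre y (u b)) := by
  refine ⟨fun p => ∀ q < p.2.length, u (ofNat γ q) ≤ p.2.length →
    D ((p.1, ofNat γ q), p.2.take (u (ofNat γ q))), ?_, fun a => exists_congr fun y => ⟨?_, ?_⟩⟩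
  · have hq : Primrec fun x : (α × List ℕ) × ℕ => ofNat γ x.2 := (Primrec.ofNat γ).comp .snd
    refine PrimrecPred.ballLT (p := fun (p : α × List ℕ) q => u (ofNat γ q) ≤ p.2.length →
      D ((p.1, ofNat γ q), p.2.take (u (ofNat γ q)))) (PrimrecPred.primrecRel
      (p := fun x : (α × List ℕ) × ℕ => u (ofNat γ x.2) ≤ x.1.2.length →
      D ((x.1.1, ofNat γ x.2), x.1.2.take (u (ofNat γ x.2)))) ?_) (Primrec.list_length.comp .snd)
    have hl : Primrec fun x : (α × List ℕ) × ℕ => x.1.2 := Primrec.snd.comp .fst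
    exact (Primrec.nat_le.comp (hu.comp hq) (Primrec.list_length.comp hl)).imp
      (hD.comp (((Primrec.fst.comp .fst).pair hq).pair
        (Primrec.list_take.comp (hu.comp hq) hl)))
  · intro h k q _ hk
    rw [pre_length] at hk
    simpa only [pre_take, min_eq_left hk] using h (ofNat γ q)
  · intro h b
    have := h (encode b + 1 + u b) (encode b) (by simp [pre_length]; omega)
      (by simp [pre_length])
    simpa only [pre_take, ofNat_encode, min_eq_left (Nat.le_add_left _ _)] using this

lemma IsSigma11.forall {γ : Type*} [Denumerable γ] {P : α × γ → Prop} (hP : IsSigma11 P) :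
    IsSigma11 fun a => ∀ b, P (a, b) := by
  obtain ⟨R, hR, hR'⟩ := hP
  have hs : Primrec fun x : (α × (γ × ℕ)) × List ℕ =>
      (List.range x.1.2.2).map fun j => x.2.getD (Nat.pair (encode x.1.2.1) j) 0 :=
    Primrec.list_map (Primrec.list_range.comp (Primrec.snd.comp (Primrec.snd.comp .fst)))
      ((Primrec.list_getD 0).comp (Primrec.snd.comp .fst) (Primrec₂.natPair.comp
        (Primrec.encode.comp
          (Primrec.fst.comp (Primrec.snd.comp (Primrec.fst.comp .fst)))) .snd)).to₂
  have := isSigma11_exists_forall (α := α) (γ := γ × ℕ)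
    (D := fun x => R ((x.1.1, x.1.2.1),
      (List.range x.1.2.2).map fun j => x.2.getD (Nat.pair (encode x.1.2.1) j) 0))
    (hR.comp (((Primrec.fst.comp .fst).pair
      (Primrec.fst.comp (Primrec.snd.comp .fst))).pair hs))
    (u := fun x => Nat.pair (encode x.1) x.2)
    (Primrec₂.natPair.comp (Primrec.encode.comp .fst) .snd)
  refine this.of_eq fun a => ?_
  have hslice : ∀ (y : Baire) (b : γ) (k : ℕ),
      ((List.range k).map fun j => (pre y (Nat.pair (encode b) k)).getD
        (Nat.pair (encode b) j) 0) = pre (fun j => y (Nat.pair (encode b) j)) k := by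
    intro y b k
    exact List.map_congr_left fun j hj =>
      pre_getD y (Nat.pair_lt_pair_right _ (List.mem_range.1 hj))
  simp only [hslice, hR', Prod.forall]
  constructor
  · rintro ⟨y, hy⟩ b
    exact ⟨_, hy b⟩
  · intro h
    choose y hy using h
    refine ⟨fun m => y (ofNat γ m.unpair.1) m.unpair.2, fun b k => ?_⟩
    simpa using hy b k

lemma IsSigma11.or {P Q : α → Prop} (hP : IsSigma11 P) (hQ : IsSigma11 Q) :
    IsSigma11 fun a => P a ∨ Q a := by
  refine (IsSigma11.exists_nat (IsSigma11.ite (c := fun x : α × ℕ => x.2 = 0)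
    (Primrec.eq.comp .snd (.const 0)) (hP.comp .fst) (hQ.comp .fst))).of_eq fun a => ?_
  constructor
  · rintro ⟨n, ⟨-, h⟩ | ⟨-, h⟩⟩
    exacts [Or.inl h, Or.inr h]
  · rintro (h | h)
    exacts [⟨0, Or.inl ⟨rfl, h⟩⟩, ⟨1, Or.inr ⟨one_ne_zero, h⟩⟩]

lemma IsSigma11.and_primrec {P c : α → Prop} (hc : PrimrecPred c) (hP : IsSigma11 P) :
    IsSigma11 fun a => c a ∧ P a := by
  refine (IsSigma11.ite hc hP (Q := fun _ => False) ?_).of_eq fun a => by simp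
  exact ⟨fun _ => False, ⟨fun _ => .isFalse id, (Primrec.const false)⟩, by simp⟩

lemma IsSigma11.uniformlySigma11 {A : ℕ → Set ℕ} (h : IsSigma11 fun p : ℕ × ℕ => p.2 ∈ A p.1) :
    UniformlySigma11 A := by
  obtain ⟨R, ⟨_, hR⟩, hR'⟩ := h
  exact ⟨fun p l => decide (R (p, l)), hR.to_comp, fun n m => by simpa using hR' (n, m)⟩

/-- The index of the position `(t, s)` together with the move `n`. -/
def moveIndex (t s : List ℕ) (n : ℕ) : ℕ := encode (t, s, n)

lemma primrec_moveIndex : Primrec fun x : List ℕ × List ℕ × ℕ => moveIndex x.1 x.2.1 x.2.2 :=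
  Primrec.encode

/-- `w` codes a strategy that keeps up with all moves in `T₁` by moves in `T₂`:
the position `(t, s)` belongs to the strategy iff `w (t, s, 0) ≠ 0`, and then the response to
the move `n` is `w (t, s, n) - 1`. -/
def IsResponse (T₁ T₂ : List ℕ → Prop) (w : ℕ → ℕ) (t s : List ℕ) (n c : ℕ) : Prop :=
  w (moveIndex [] [] 0) ≠ 0 ∧ (w (moveIndex t s 0) ≠ 0 → T₁ (t ++ [n]) →
    w (moveIndex t s n) ≠ 0 ∧ (w (moveIndex t s n) = c + 1 →
      T₂ (s ++ [c]) ∧ w (moveIndex (t ++ [n]) (s ++ [c]) 0) ≠ 0))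

lemma not_outruns_iff {T₁ T₂ : List ℕ → Prop} :
    ¬ Outruns T₁ T₂ [] [] ↔ ∃ w : Baire, ∀ t s n c, IsResponse T₁ T₂ w t s n c := by
  classical
  constructor
  · intro h
    let r : List ℕ → List ℕ → ℕ → ℕ := fun t s n =>
      if Outruns T₁ T₂ t s then 0 else
        if h : ∃ c, T₂ (s ++ [c]) ∧ ¬ Outruns T₁ T₂ (t ++ [n]) (s ++ [c]) then h.choose + 1 else 1
    have hr : ∀ t s n, r t s n ≠ 0 ↔ ¬ Outruns T₁ T₂ t s := fun t s n => by
      simp only [r]; split_ifs <;> simp_all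
    let w : Baire := fun m =>
      let x := ofNat (List ℕ × List ℕ × ℕ) m
      r x.1 x.2.1 x.2.2
    have hw : ∀ t s n, w (moveIndex t s n) = r t s n := fun t s n => by
      simp [w, moveIndex]
    refine ⟨w, fun t s n c => ?_⟩
    simp only [IsResponse, hw, hr]
    refine ⟨h, fun hts hn => ⟨hts, fun hc => ?_⟩⟩
    have hex := exists_response hts hn
    simp only [r, if_neg hts, dif_pos hex, add_left_inj] at hc
    exact hc ▸ hex.choose_spec
  · rintro ⟨w, hw⟩ h
    suffices H : ∀ t s, Outruns T₁ T₂ t s → w (moveIndex t s 0) = 0 from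
      (hw [] [] 0 0).1 (H _ _ h)
    intro t s hts
    induction hts with
    | @step t s n hn _ ih =>
      by_contra h0
      obtain ⟨c, hc⟩ := Nat.exists_eq_succ_of_ne_zero ((hw t s n 0).2 h0 hn).1
      obtain ⟨h1, h2⟩ := ((hw t s n c).2 h0 hn).2 hc
      exact h2 (ih c h1)

lemma isSigma11_not_outruns {T₁ T₂ : α → List ℕ → Prop} (h₁ : PrimrecRel T₁)
    (h₂ : PrimrecRel T₂) : IsSigma11 fun a => ¬ Outruns (T₁ a) (T₂ a) [] [] := by
  let γ := List ℕ × List ℕ × ℕ × ℕ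
  let u : γ → ℕ := fun b => moveIndex [] [] 0 + moveIndex b.1 b.2.1 0 +
    moveIndex b.1 b.2.1 b.2.2.1 +
    moveIndex (b.1 ++ [b.2.2.1]) (b.2.1 ++ [b.2.2.2]) 0 + 1
  let D : (α × γ) × List ℕ → Prop := fun x => IsResponse (T₁ x.1.1) (T₂ x.1.1)
    (fun m => x.2.getD m 0) x.1.2.1 x.1.2.2.1 x.1.2.2.2.1 x.1.2.2.2.2
  have ht : Primrec fun b : γ => b.1 := .fst
  have hs : Primrec fun b : γ => b.2.1 := Primrec.fst.comp .snd
  have hn : Primrec fun b : γ => b.2.2.1 := Primrec.fst.comp (Primrec.snd.comp .snd)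
  have hc : Primrec fun b : γ => b.2.2.2 := Primrec.snd.comp (Primrec.snd.comp .snd)
  have htn : Primrec fun b : γ => b.1 ++ [b.2.2.1] := Primrec.list_concat.comp ht hn
  have hsc : Primrec fun b : γ => b.2.1 ++ [b.2.2.2] := Primrec.list_concat.comp hs hc
  have i0 : Primrec fun b : γ => moveIndex b.1 b.2.1 0 :=
    primrec_moveIndex.comp (ht.pair (hs.pair (.const 0)))
  have i1 : Primrec fun b : γ => moveIndex b.1 b.2.1 b.2.2.1 :=
    primrec_moveIndex.comp (ht.pair (hs.pair hn))
  have i2 : Primrec fun b : γ => moveIndex (b.1 ++ [b.2.2.1]) (b.2.1 ++ [b.2.2.2]) 0 :=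
    primrec_moveIndex.comp (htn.pair (hsc.pair (.const 0)))
  have hu : Primrec u := Primrec.succ.comp (Primrec.nat_add.comp
    (Primrec.nat_add.comp (Primrec.nat_add.comp (.const _) i0) i1) i2)
  have hb : Primrec fun x : (α × γ) × List ℕ => x.1.2 := Primrec.snd.comp .fst
  have ha : Primrec fun x : (α × γ) × List ℕ => x.1.1 := Primrec.fst.comp .fst
  have hget : ∀ {f : γ → ℕ}, Primrec f →
      Primrec fun x : (α × γ) × List ℕ => x.2.getD (f x.1.2) 0 := fun hf =>
    (Primrec.list_getD 0).comp .snd (hf.comp hb)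
  have hne : ∀ {f : γ → ℕ}, Primrec f →
      PrimrecPred fun x : (α × γ) × List ℕ => x.2.getD (f x.1.2) 0 ≠ 0 := fun hf =>
    PrimrecPred.not (Primrec.eq.comp (hget hf) (.const 0))
  have hD : PrimrecPred D := (hne (.const _)).and ((hne i0).imp ((h₁.comp ha (htn.comp hb)).imp
    ((hne i1).and (PrimrecPred.imp
      (Primrec.eq.comp (hget i1) (Primrec.succ.comp (hc.comp hb)))
      ((h₂.comp ha (hsc.comp hb)).and (hne i2))))))
  refine (isSigma11_exists_forall hD hu).of_eq fun a => ?_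
  rw [not_outruns_iff]
  refine exists_congr fun w => ?_
  have key : ∀ b : γ, D ((a, b), pre w (u b)) ↔
      IsResponse (T₁ a) (T₂ a) w b.1 b.2.1 b.2.2.1 b.2.2.2 := fun b => by
    simp only [D, IsResponse]
    rw [pre_getD w (show moveIndex [] [] 0 < u b by simp only [u]; omega),
      pre_getD w (show moveIndex b.1 b.2.1 0 < u b by simp only [u]; omega),
      pre_getD w (show moveIndex b.1 b.2.1 b.2.2.1 < u b by simp only [u]; omega),
      pre_getD w (show moveIndex (b.1 ++ [b.2.2.1]) (b.2.1 ++ [b.2.2.2]) 0 < u b by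
        simp only [u]; omega)]
  simp only [key]
  exact ⟨fun h t s n c => h (t, s, n, c), fun h b => h _ _ _ _⟩

end Sigma

/-! ### Universal computation -/

/-- The value seen on `t` of the function coded by `e`, at parameter `p` and some initial segment
of `t`; both the segment and the number of steps of the computation are given by the length
of `t`. -/
def probe (e : ℕ) (p : ℕ × ℕ) (t : List ℕ) : Option ℕ :=
  Nat.Partrec.Code.evaln t.length.unpair.1 (ofNat Nat.Partrec.Code e)
    (encode (p, t.take t.length.unpair.2))

lemma primrec_probe : Primrec fun x : ℕ × (ℕ × ℕ) × List ℕ => probe x.1 x.2.1 x.2.2 := by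
  have ht : Primrec fun x : ℕ × (ℕ × ℕ) × List ℕ => x.2.2 := Primrec.snd.comp .snd
  have hl : Primrec fun x : ℕ × (ℕ × ℕ) × List ℕ => x.2.2.length.unpair :=
    Primrec.unpair.comp (Primrec.list_length.comp ht)
  exact Nat.Partrec.Code.primrec_evaln.comp (((Primrec.fst.comp hl).pair
    ((Primrec.ofNat _).comp .fst)).pair (Primrec.encode.comp ((Primrec.fst.comp .snd).pair
      (Primrec.list_take.comp (Primrec.snd.comp hl) ht))))

lemma probe_nil (e : ℕ) (p : ℕ × ℕ) : probe e p [] = none := by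
  simp [probe, Nat.Partrec.Code.evaln]

lemma exists_probe {f : (ℕ × ℕ) × List ℕ → ℕ} (hf : Computable f) :
    ∃ e, (∀ p t v, probe e p t = some v → ∃ j ≤ t.length, v = f (p, t.take j)) ∧
      ∀ p x j, ∃ m, probe e p (pre x m) = some (f (p, pre x j)) := by
  obtain ⟨c, hc⟩ := Nat.Partrec.Code.exists_code.1 hf
  have hc' : ∀ a, c.eval (encode a) = Part.some (f a) := fun a => by
    rw [hc]
    simp only [encodek, Part.coe_some, Part.bind_some]
    simp
  refine ⟨encode c, fun p t v h => ⟨_, Nat.unpair_right_le _, ?_⟩, fun p x j => ?_⟩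
  · have := Nat.Partrec.Code.evaln_sound h
    rw [ofNat_encode, hc'] at this
    simpa using this
  · obtain ⟨k, hk⟩ := Nat.Partrec.Code.evaln_complete.1
      (show f (p, pre x j) ∈ c.eval (encode (p, pre x j)) by rw [hc']; exact Part.mem_some _)
    refine ⟨Nat.pair k j, ?_⟩
    rw [probe, pre_length, pre_take, Nat.unpair_pair, ofNat_encode,
      min_eq_left (Nat.right_le_pair k j)]
    exact hk

/-- Membership trees of the family coded by the first component of `n`. -/
def memTree (n i k : ℕ) (t : List ℕ) : Prop := probe n.unpair.1 (i, k) t ≠ some 0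

/-- The `n`-th output of the functional coded by the second component of `n`, increased by one,
or `0` if it is not yet seen. -/
def output (n : ℕ) (t : List ℕ) : ℕ := (probe n.unpair.2 (n, 0) t).getD 0

section Primrec

variable {α : Type*} [Primcodable α] {n i k : α → ℕ} {t : α → List ℕ}

lemma primrecPred_memTree (hn : Primrec n) (hi : Primrec i) (hk : Primrec k) (ht : Primrec t) :
    PrimrecPred fun a => memTree (n a) (i a) (k a) (t a) :=
  (Primrec.eq.comp (primrec_probe.comp ((Primrec.fst.comp (Primrec.unpair.comp hn)).pair
    ((hi.pair hk).pair ht))) (.const (some 0))).not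

lemma primrec_output (hn : Primrec n) (ht : Primrec t) :
    Primrec fun a => output (n a) (t a) :=
  Primrec.option_getD.comp (primrec_probe.comp ((Primrec.snd.comp (Primrec.unpair.comp hn)).pair
    ((hn.pair (.const 0)).pair ht))) (.const 0)

lemma primrecPred_compTree (hn : Primrec n) (hi : Primrec i) (hk : Primrec k) (ht : Primrec t) :
    PrimrecPred fun a => compTree (memTree (n a)) (i a) (k a) (t a) :=
  primrecPred_memTree hn hi hk (Primrec.list_drop.comp hi ht)

lemma primrecPred_boundTree (hn : Primrec n) (hi : Primrec i) (hk : Primrec k)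
    (ht : Primrec t) : PrimrecPred fun a => boundTree (memTree (n a)) (i a) (k a) (t a) :=
  (Primrec.nat_le.comp hk (Primrec.list_headI.comp ht)).and
    (primrecPred_memTree hn hi (Primrec.list_headI.comp ht) (Primrec.list_tail.comp ht))

lemma primrec_track (ht : Primrec t) (hi : Primrec i) :
    Primrec fun a => track (t a) (i a) := by
  have h : Primrec fun x : α × ℕ => (ofNat (List ℕ) x.2.unpair.2).getD (i x.1) 0 :=
    (Primrec.list_getD 0).comp ((Primrec.ofNat _).comp
      (Primrec.snd.comp (Primrec.unpair.comp .snd))) (hi.comp .fst)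
  exact Primrec.list_map (Primrec.list_drop.comp hi ht) h.to₂

lemma primrecPred_undefTree (hn : Primrec n) (ht : Primrec t) :
    PrimrecPred fun a => undefTree (output (n a)) (memTree (n a)) (t a) := by
  have hx : Primrec fun a => (t a).map fun z => z.unpair.1 :=
    Primrec.list_map ht (Primrec.fst.comp (Primrec.unpair.comp .snd)).to₂
  have h1 : PrimrecPred fun a => output (n a) ((t a).map fun z => z.unpair.1) = 0 :=
    Primrec.eq.comp (primrec_output hn hx) (.const 0)
  have h2 : PrimrecPred fun x : α × ℕ => memTree (n x.1) x.2
      (((t x.1).map fun z => z.unpair.1).getD x.2 0) (track (t x.1) x.2) :=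
    primrecPred_memTree (hn.comp .fst) .snd ((Primrec.list_getD 0).comp (hx.comp .fst) .snd)
      (primrec_track (ht.comp .fst) .snd)
  exact h1.and (PrimrecPred.ballLT h2.primrecRel (Primrec.list_length.comp ht))

lemma primrecPred_settles {v : α → ℕ} (hn : Primrec n) (hv : Primrec v) (ht : Primrec t) :
    PrimrecPred fun a => Settles (output (n a)) (v a) (t a) := by
  refine (Primrec.eq.comp (primrec_output hn ht) (Primrec.succ.comp hv)).and
    (PrimrecPred.ballLT (p := fun a j => output (n a) ((t a).take j) = 0)
      (PrimrecPred.primrecRel (p := fun x : α × ℕ => output (n x.1) ((t x.1).take x.2) = 0) ?_)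
      (Primrec.list_length.comp ht))
  exact Primrec.eq.comp (primrec_output (hn.comp .fst)
    (Primrec.list_take.comp .snd (ht.comp .fst))) (.const 0)

lemma isSigma11_not_cand (hn : Primrec n) (hi : Primrec i) (hk : Primrec k) :
    IsSigma11 fun a => ¬ Cand (output (n a)) (memTree (n a)) (i a) (k a) := by
  have h1 : IsSigma11 fun a => ¬ Outruns (compTree (memTree (n a)) (i a) (k a))
      (undefTree (output (n a)) (memTree (n a))) [] [] :=
    isSigma11_not_outruns
      (PrimrecPred.primrecRel (primrecPred_compTree (hn.comp .fst) (hi.comp .fst)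
        (hk.comp .fst) .snd))
      (PrimrecPred.primrecRel (primrecPred_undefTree (hn.comp .fst) .snd))
  have h2 : IsSigma11 fun x : α × ℕ => ¬ Outruns (boundTree (memTree (n x.1)) (i x.1) (k x.1))
      (boundTree (memTree (n x.1)) (i x.1) x.2) [] [] :=
    have fst' : Primrec fun y : (α × ℕ) × List ℕ => y.1.1 := Primrec.fst.comp .fst
    isSigma11_not_outruns
      (PrimrecPred.primrecRel (primrecPred_boundTree (hn.comp fst') (hi.comp fst')
        (hk.comp fst') .snd))
      (PrimrecPred.primrecRel (primrecPred_boundTree (hn.comp fst') (hi.comp fst')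
        (Primrec.snd.comp .fst) .snd))
  refine ((h2.forall.and_primrec (c := fun a => k a ≠ 0)
    (Primrec.eq.comp hk (.const 0)).not).or h1).of_eq fun a => ?_
  simp only [Cand, ← not_exists]
  tauto

end Primrec

lemma isSigma11_not_removed :
    IsSigma11 fun p : ℕ × ℕ => ¬ Removed (output p.1) (memTree p.1) p.2 := by
  have hσ : Primrec fun x : ((ℕ × ℕ) × List ℕ) × ℕ => x.1.2 := Primrec.snd.comp .fst
  have hn : Primrec fun x : (ℕ × ℕ) × List ℕ => x.1.1 := Primrec.fst.comp .fst
  have h1 := isSigma11_not_cand (hn.comp (.fst (β := ℕ))) .snd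
    ((Primrec.list_getD 0).comp hσ .snd)
  have h2 := (h1.and_primrec
    (Primrec.nat_lt.comp .snd (Primrec.list_length.comp hσ))).exists_nat
  have h3 := (primrecPred_settles hn (Primrec.snd.comp .fst) .snd).not.isSigma11
  refine (h3.or h2).forall.of_eq fun p => ?_
  simp only [Removed, not_exists, not_and, not_forall, exists_prop]
  exact forall_congr' fun σ => by tauto

/-! ### Diagonalization -/

lemma cand_of_mem {g : List ℕ → ℕ} {N : ℕ → ℕ → List ℕ → Prop} {B : ℕ → Set ℕ}
    (hB : ∀ i k, k ∈ B i ↔ ∃ y : Baire, ∀ m, N i k (pre y m)) (hN : ∀ i k, N i k [])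
    (hg : g [] = 0) (hdef : ∀ x ∈ homProd B, ∃ m, g (pre x m) ≠ 0) {i k : ℕ} (hk : k ∈ B i)
    (hfin : k ≠ 0 → (B i).Finite) : Cand g N i k := by
  obtain ⟨y, hy⟩ := (hB i k).1 hk
  refine ⟨or_iff_not_imp_left.2 fun hk0 => ?_, ?_⟩
  · obtain ⟨b, hb⟩ := (hfin hk0).bddAbove
    refine ⟨b + 1, ?_⟩
    by_contra h
    obtain ⟨z, hz⟩ := exists_path_of_not_outruns h (y := fun j => Nat.casesOn j k y) fun m => by
      rw [pre_succ']
      exact ⟨le_rfl, hy m⟩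
    simp only [pre_succ'] at hz
    exact absurd (hb ((hB i (z 0)).2 ⟨_, fun m => (hz m).2⟩)) (not_le.2 (hz 0).1)
  · by_contra h
    obtain ⟨z, hz⟩ := exists_path_of_not_outruns h (y := fun j => y (j - i)) fun m => by
      rw [compTree, pre_drop]
      simpa using hy _
    simp only [undefTree, pre_map, pre_length, track_pre] at hz
    obtain ⟨m, hm⟩ := hdef (fun j => (z j).unpair.1) fun l =>
      (hB l _).2 ⟨fun j => (ofNat (List ℕ) (z (l + j)).unpair.2).getD l 0, fun m => by
        rcases m with _ | m
        · exact hN l _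
        · have := (hz (l + m)).2 l (by omega)
          rwa [pre_getD _ (by omega), show l + m + 1 - l = m + 1 by omega] at this⟩
    rcases m with _ | m
    · exact hm hg
    · exact hm (hz m).1

lemma TuringFunctional.Eval.eq {Φ : TuringFunctional} {x y : Baire} (h : Φ.Eval x y) {n j v : ℕ}
    (hv : (Φ.φ (pre x j))[n]? = some v) : v = y n := by
  obtain ⟨m, hm⟩ := h n
  have h1 : ∀ {a b w}, a ≤ b → (Φ.φ (pre x a))[n]? = some w →
      (Φ.φ (pre x b))[n]? = some w := fun {a b w} hab hw => by
    have hp := List.take_prefix a (pre x b)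
    rw [pre_take, min_eq_left hab] at hp
    obtain ⟨ρ, hρ⟩ := Φ.mono _ _ hp
    rw [← hρ, List.getElem?_append_left (List.getElem?_eq_some_iff.1 hw).1, hw]
  rcases le_total j m with hjm | hjm
  · exact Option.some_injective _ ((h1 hjm hv).symm.trans hm)
  · exact Option.some_injective _ (hv.symm.trans (h1 hjm hm))

/-- There is a uniformly `Σ¹₁` family of cofinite sets whose product is not
Medvedev reducible to any all-or-(nonempty-finite) homogeneous `Σ¹₁` set. -/
theorem exists_cofinite_not_below_aof :
    ∃ A : ℕ → Set ℕ, UniformlySigma11 A ∧ (∀ n, (A n)ᶜ.Finite) ∧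
      ∀ B : ℕ → Set ℕ, UniformlySigma11 B →
        (∀ n, B n = Set.univ ∨ ((B n).Nonempty ∧ (B n).Finite)) →
        ¬ MedvedevLE (homProd A) (homProd B) := by
  refine ⟨fun n => {v | ¬ Removed (output n) (memTree n) v},
    isSigma11_not_removed.uniformlySigma11, fun n => ?_, ?_⟩
  · exact removed_finite.subset fun v hv => not_not.1 hv
  rintro B ⟨R, hR, hBR⟩ hB ⟨Φ, hΦ⟩
  obtain ⟨d, hd, hd'⟩ := exists_probe (f := fun x => encode (R x.1 x.2))
    (Computable.encode.comp hR)
  obtain ⟨e, he, he'⟩ := exists_probe (f := fun x => encode (Φ.φ x.2)[x.1.1]?)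
    (Computable.encode.comp (Computable.list_getElem?.comp (Φ.computable.comp .snd)
      (Computable.fst.comp .fst)))
  let n := Nat.pair d e
  have hmem : ∀ i k, k ∈ B i ↔ ∃ y : Baire, ∀ m, memTree n i k (pre y m) := fun i k => by
    rw [hBR]
    refine exists_congr fun y => ⟨fun h m hm => ?_, fun h j => ?_⟩
    · obtain ⟨j, -, hj⟩ := hd (i, k) (pre y m) 0 (by simpa [memTree, n] using hm)
      rw [pre_take] at hj
      simp [h] at hj
    · obtain ⟨m, hm⟩ := hd' (i, k) y j
      have := h m
      by_contra hj
      rw [Bool.not_eq_true] at hj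
      simp [memTree, n, hm, hj] at this
  have hdef : ∀ x ∈ homProd B, ∃ m, output n (pre x m) ≠ 0 := fun x hx => by
    obtain ⟨y, -, hy⟩ := hΦ x hx
    obtain ⟨j, hj⟩ := hy n
    obtain ⟨m, hm⟩ := he' (n, 0) x j
    refine ⟨m, ?_⟩
    simp only [hj] at hm
    simp [output, n, hm]
  have hsel : ∀ i, ∃ k ∈ B i, k ≠ 0 → (B i).Finite := fun i => by
    rcases hB i with h | ⟨⟨k, hk⟩, hf⟩
    · exact ⟨0, h ▸ Set.mem_univ 0, fun h0 => absurd rfl h0⟩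
    · exact ⟨k, hk, fun _ => hf⟩
  choose x hxB hxf using hsel
  obtain ⟨y, hyA, hy⟩ := hΦ x hxB
  classical
  let m := Nat.find (hdef x hxB)
  have hm : output n (pre x m) ≠ 0 := Nat.find_spec (hdef x hxB)
  have hval : output n (pre x m) = y n + 1 := by
    obtain ⟨w, hw⟩ : ∃ w, probe e (n, 0) (pre x m) = some w := by
      refine Option.ne_none_iff_exists'.1 fun h => hm ?_
      simp [output, n, Nat.unpair_pair, show probe e (Nat.pair d e, 0) (pre x m) = none from h]
    have hw' : output n (pre x m) = w := by
      simp [output, n, Nat.unpair_pair, show probe e (Nat.pair d e, 0) (pre x m) = some w from hw]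
    obtain ⟨j, -, hj⟩ := he _ _ _ hw
    rw [hw'] at hm ⊢
    simp only [pre_take] at hj
    rcases hv : (Φ.φ (pre x (min j m)))[n]? with _ | v
    · exact absurd (by simpa [hv] using hj) hm
    · rw [hj, ← hy.eq hv, hv]
      rfl
  refine hyA n ⟨pre x m, ⟨hval, fun j hj => ?_⟩, fun i hi => ?_⟩
  · rw [pre_length] at hj
    rw [pre_take, min_eq_left hj.le]
    exact not_not.1 (Nat.find_min (hdef x hxB) hj)
  · rw [pre_length] at hi
    rw [pre_getD x hi]
    exact cand_of_mem hmem (fun i k => by simp [memTree, probe_nil])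
      (by simp [output, probe_nil]) hdef (hxB i) (hxf i)
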